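/- For every n ≥ 1 there exists ε > 0 such that for every failure probability p ∈ (1−ε, 1), the single-cluster placement x^sgl, defined by x^sgl_i = 1/2 for all i ∈ {1,…,n}, is optimal: C(x^sgl) ≤ C(x) for all x ∈ [0,1]^n (where C depends on p). -/

import Mathlib

open Finset MeasureTheory

/-- Coverage cost on the line `[0,1]` for placement `x` and active set `A`:
the largest distance from a point of `[0,1]` to the closest active sensor
(`1` by convention if `A = ∅`). -/
noncomputable def cost0 {n : ℕ} (x : Fin n → ℝ) (A : Finset (Fin n)) : ℝ :=
  if A.Nonempty then ⨆ s : Set.Icc (0:ℝ) 1, ⨅ j : A, |s.1 - x j.1| else 1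

/-- Probability that `A` is the active set, under independent failures with
probability `p`. -/
noncomputable def prob {n : ℕ} (p : ℝ) (A : Finset (Fin n)) : ℝ :=
  p ^ (n - A.card) * (1 - p) ^ A.card

/-- Expected coverage cost `C(x)` under independent failures with probability `p`. -/
noncomputable def expCost {n : ℕ} (p : ℝ) (x : Fin n → ℝ) : ℝ :=
  ∑ A : Finset (Fin n), prob p A * cost0 x A

/-- The equispaced placement `x^eq`, whose `i`-th entry (`i = 0, …, n-1`) is
`(2i+1)/(2n)`. -/
noncomputable def xeq (n : ℕ) : Fin n → ℝ := fun i => (2 * (i : ℝ) + 1) / (2 * n)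

/-- The `k`-th smallest element of the finite set `A` (0-based). -/
noncomputable def nth {n : ℕ} (A : Finset (Fin n)) (k : Fin A.card) : Fin n :=
  (A.orderIsoOfFin rfl k).1

/-- Coverage cost on the circle of circumference 1 for the active set `A`. -/
noncomputable def ccost0 {n : ℕ} (x : Fin n → ℝ) (A : Finset (Fin n)) : ℝ :=
  if A.Nonempty then
    ⨆ s : Set.Icc (0:ℝ) 1, ⨅ j : A, min |s.1 - x j.1| (1 - |s.1 - x j.1|)
  else 1

/-- Expected circle coverage cost `C̃(x)`. -/
noncomputable def cExpCost {n : ℕ} (p : ℝ) (x : Fin n → ℝ) : ℝ :=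
  ∑ A : Finset (Fin n), prob p A * ccost0 x A

/-- Harmonic number `H_m = ∑_{h=1}^m 1/h`. -/
noncomputable def H (m : ℕ) : ℝ := ∑ i ∈ Finset.range m, 1 / ((i : ℝ) + 1)

/-- Length of the longest run of consecutive indices of `{0, …, n-1}` not
belonging to `A`. -/
noncomputable def longestRun {n : ℕ} (A : Finset (Fin n)) : ℕ :=
  sSup {r : ℕ | ∃ a : ℕ, a + r ≤ n ∧ ∀ i : Fin n, a ≤ i.1 → i.1 < a + r → i ∉ A}

/-- Expected cost in the Cortés (constant-number-of-failures) model where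
exactly `k` sensors fail, uniformly at random. -/
noncomputable def cortesCost {n : ℕ} (k : ℕ) (x : Fin n → ℝ) : ℝ :=
  (n.choose k : ℝ)⁻¹ *
    ∑ A ∈ Finset.univ.filter (fun A : Finset (Fin n) => A.card = n - k), cost0 x A

/-- Expectation over the random uniform i.i.d. placement `x^rand ∈ [0,1]^n`
of the expected cost `C(x^rand)`. -/
noncomputable def randExp (n : ℕ) (p : ℝ) : ℝ :=
  ∫ x in Set.univ.pi (fun _ : Fin n => Set.Icc (0:ℝ) 1), expCost p x

/-- `E[C_0(x^{rand,m})]`: expected coverage cost of `m` i.i.d. uniform sensors,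
all active. -/
noncomputable def randCost0 (m : ℕ) : ℝ :=
  ∫ x in Set.univ.pi (fun _ : Fin m => Set.Icc (0:ℝ) 1), cost0 x Finset.univ

/-- `E[C^{k,n}(x^rand)]`: expectation over the random placement of the Cortés
model cost. -/
noncomputable def randCortes (n k : ℕ) : ℝ :=
  ∫ x in Set.univ.pi (fun _ : Fin n => Set.Icc (0:ℝ) 1), cortesCost k x

/-- A lower bound on the distance from one point of `[0,1]` to all active sensors bounds the
coverage cost from below. -/
lemma le_cost0 {n : ℕ} {x : Fin n → ℝ} (hx : ∀ i, x i ∈ Set.Icc (0:ℝ) 1)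
    {A : Finset (Fin n)} (hA : A.Nonempty) {s : ℝ} (hs : s ∈ Set.Icc (0:ℝ) 1) {c : ℝ}
    (h : ∀ j ∈ A, c ≤ |s - x j|) : c ≤ cost0 x A := by
  rw [cost0, if_pos hA]
  have : Nonempty A := hA.to_subtype
  have hbdd : ∀ t : ℝ, BddBelow (Set.range fun j : A => |t - x j.1|) :=
    fun t => ⟨0, by rintro _ ⟨j, rfl⟩; exact abs_nonneg _⟩
  refine le_ciSup_of_le (f := fun s : Set.Icc (0:ℝ) 1 => ⨅ j : A, |s.1 - x j.1|)
    ⟨1, ?_⟩ ⟨s, hs⟩ (le_ciInf fun j => h j.1 j.2)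
  rintro _ ⟨t, rfl⟩
  obtain ⟨j, hj⟩ := hA
  refine (ciInf_le (hbdd t.1) ⟨j, hj⟩).trans ?_
  have h1 := hx j
  have h2 := t.2
  exact abs_le.2 ⟨by linarith [h1.1, h1.2, h2.1, h2.2], by linarith [h1.1, h1.2, h2.1, h2.2]⟩

/-- The single cluster at `1/2` has coverage cost at most `1/2` as soon as one sensor is active. -/
lemma cost0_half_le {n : ℕ} {A : Finset (Fin n)} (hA : A.Nonempty) :
    cost0 (fun _ : Fin n => (1:ℝ)/2) A ≤ 1/2 := by
  rw [cost0, if_pos hA]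
  have : Nonempty A := hA.to_subtype
  have : Nonempty (Set.Icc (0:ℝ) 1) := ⟨⟨0, by simp⟩⟩
  refine ciSup_le fun s => ?_
  rw [ciInf_const]
  exact abs_le.2 ⟨by linarith [s.2.1], by linarith [s.2.2]⟩

/-- Moving a lone sensor away from `1/2` raises its coverage cost by the displacement. -/
lemma half_add_abs_le_cost0_singleton {n : ℕ} {x : Fin n → ℝ}
    (hx : ∀ i, x i ∈ Set.Icc (0:ℝ) 1) (i : Fin n) :
    1/2 + |x i - 1/2| ≤ cost0 x {i} := by
  rcases le_total (x i) (1/2) with h | h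
  · refine le_cost0 hx (singleton_nonempty i) (s := 1) (by simp) fun j hj => ?_
    rw [mem_singleton.1 hj, abs_of_nonpos (by linarith)]
    exact le_trans (by linarith) (le_abs_self _)
  · refine le_cost0 hx (singleton_nonempty i) (s := 0) (by simp) fun j hj => ?_
    rw [mem_singleton.1 hj, abs_of_nonneg (by linarith)]
    exact le_trans (by linarith) (neg_le_abs _)

/-- Moving the sensors away from `1/2` lowers the coverage cost by at most the total
displacement. -/
lemma half_sub_sum_le_cost0 {n : ℕ} {x : Fin n → ℝ} (hx : ∀ i, x i ∈ Set.Icc (0:ℝ) 1)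
    {A : Finset (Fin n)} (hA : A.Nonempty) :
    1/2 - ∑ i, |x i - 1/2| ≤ cost0 x A := by
  refine le_cost0 hx hA (s := 0) (by simp) fun j _ => ?_
  have h := single_le_sum (f := fun i => |x i - 1/2|) (fun i _ => abs_nonneg _) (mem_univ j)
  have h1 := neg_le_abs (x j - 1/2)
  have h2 := neg_le_abs (0 - x j)
  linarith

lemma prob_nonneg {n : ℕ} {p : ℝ} (hp0 : 0 ≤ p) (hp1 : p ≤ 1) (A : Finset (Fin n)) :
    0 ≤ prob p A :=
  mul_nonneg (pow_nonneg hp0 _) (pow_nonneg (by linarith) _)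

lemma prob_le_sq {n : ℕ} {p : ℝ} (hp0 : 0 ≤ p) (hp1 : p ≤ 1) {A : Finset (Fin n)}
    (hA : 2 ≤ A.card) : prob p A ≤ (1 - p) ^ 2 := by
  have h1 : p ^ (n - A.card) ≤ 1 := pow_le_one₀ hp0 hp1
  have h2 : (1 - p) ^ A.card ≤ (1 - p) ^ 2 :=
    pow_le_pow_of_le_one (by linarith) (by linarith) hA
  calc prob p A ≤ 1 * (1 - p) ^ 2 :=
        mul_le_mul h1 h2 (pow_nonneg (by linarith) _) zero_le_one
    _ = (1 - p) ^ 2 := one_mul _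

lemma le_prob_singleton {n : ℕ} {p : ℝ} (hp0 : 1/2 ≤ p) (hp1 : p ≤ 1) (i : Fin n) :
    (1/2) ^ n * (1 - p) ≤ prob p {i} := by
  rw [prob, card_singleton, pow_one]
  refine mul_le_mul_of_nonneg_right ?_ (by linarith)
  calc ((1:ℝ)/2) ^ n ≤ (1/2) ^ (n - 1) :=
        pow_le_pow_of_le_one (by norm_num) (by norm_num) (Nat.sub_le _ _)
    _ ≤ p ^ (n - 1) := pow_le_pow_left₀ (by norm_num) hp0 _

/-- Contribution of one active set to the cost difference: a gain for singletons, and a loss of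
second order in `1 - p` otherwise. -/
lemma prob_mul_cost0_half_le {n : ℕ} {p : ℝ} (hp0 : 1/2 ≤ p) (hp1 : p ≤ 1) {x : Fin n → ℝ}
    (hx : ∀ i, x i ∈ Set.Icc (0:ℝ) 1) (A : Finset (Fin n)) :
    prob p A * cost0 (fun _ : Fin n => (1:ℝ)/2) A +
        (if A.card = 1 then (1/2) ^ n * (1 - p) * ∑ i ∈ A, |x i - 1/2| else 0) ≤
      prob p A * cost0 x A + (1 - p) ^ 2 * ∑ i, |x i - 1/2| := by
  have hD : 0 ≤ ∑ i, |x i - 1/2| := sum_nonneg fun i _ => abs_nonneg _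
  have hP := prob_nonneg (by linarith) hp1 A
  have hE : 0 ≤ (1 - p) ^ 2 * ∑ i, |x i - 1/2| := mul_nonneg (sq_nonneg _) hD
  rcases A.eq_empty_or_nonempty with rfl | hA
  · simpa [cost0] using hE
  have hc := mul_le_mul_of_nonneg_left (cost0_half_le hA) hP
  by_cases h1 : A.card = 1
  · obtain ⟨i, rfl⟩ := card_eq_one.1 h1
    rw [if_pos h1, sum_singleton]
    have h2 := mul_le_mul_of_nonneg_left (half_add_abs_le_cost0_singleton hx i) hP
    have h3 := mul_le_mul_of_nonneg_right (le_prob_singleton hp0 hp1 i) (abs_nonneg (x i - 1/2))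
    linarith
  · rw [if_neg h1]
    have h2 := mul_le_mul_of_nonneg_left (half_sub_sum_le_cost0 hx hA) hP
    have h3 := mul_le_mul_of_nonneg_right
      (prob_le_sq (by linarith) hp1 (A := A) (by have := hA.card_pos; omega)) hD
    linarith

lemma sum_ite_card_eq_one {n : ℕ} (f : Fin n → ℝ) (c : ℝ) :
    ∑ A : Finset (Fin n), (if A.card = 1 then c * ∑ i ∈ A, f i else 0) = c * ∑ i, f i := by
  have h : (univ.filter fun A : Finset (Fin n) => A.card = 1) = powersetCard 1 univ := by
    ext A; simp [mem_powersetCard]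
  rw [← sum_filter, h, powersetCard_one, sum_map, mul_sum]
  simp

/-- for every `n ≥ 1` there is `ε > 0` such that for every
failure probability `p ∈ (1-ε, 1)` the single-cluster placement
`x^sgl_i = 1/2` is optimal. -/
theorem xsgl_optimal_large_p {n : ℕ} (hn : 1 ≤ n) :
    ∃ ε : ℝ, 0 < ε ∧ ∀ p : ℝ, 1 - ε < p → p < 1 →
      ∀ x : Fin n → ℝ, (∀ i, x i ∈ Set.Icc (0:ℝ) 1) →
        expCost p (fun _ : Fin n => (1:ℝ)/2) ≤ expCost p x := by
  refine ⟨(1/4) ^ n, by positivity, fun p hp hp1 x hx => ?_⟩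
  have h4 : ((1:ℝ)/4) ^ n ≤ 1/4 := pow_le_of_le_one (by norm_num) (by norm_num) (by omega)
  have hsum := sum_le_sum fun (A : Finset (Fin n)) (_ : A ∈ univ) =>
    prob_mul_cost0_half_le (by linarith) hp1.le hx A
  rw [sum_add_distrib, sum_add_distrib, sum_ite_card_eq_one, sum_const, card_univ,
    Fintype.card_finset, Fintype.card_fin, nsmul_eq_mul] at hsum
  push_cast at hsum
  have hD : 0 ≤ ∑ i, |x i - 1/2| := sum_nonneg fun i _ => abs_nonneg _
  have hpow : (2:ℝ) ^ n * (1 - p) ≤ (1/2) ^ n := by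
    calc (2:ℝ) ^ n * (1 - p) ≤ 2 ^ n * (1/4) ^ n :=
          mul_le_mul_of_nonneg_left (by linarith) (by positivity)
      _ = (1/2) ^ n := by rw [← mul_pow]; norm_num
  have hloss : (2:ℝ) ^ n * ((1 - p) ^ 2 * ∑ i, |x i - 1/2|) ≤
      (1/2) ^ n * (1 - p) * ∑ i, |x i - 1/2| := by
    have := mul_le_mul_of_nonneg_right hpow (mul_nonneg (sub_nonneg.2 hp1.le) hD)
    linarith
  unfold expCost
  linarith
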